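/- arXiv:2101.00127 — 5 statements merged into one kernel-verified Lean document; each statement's English description precedes it below -/
import Mathlib

section
/- Let G be a simple graph on a vertex type V with a bipartition b (a proper coloring of G by a two-element type, with color classes V₁ = b⁻¹(0) and V₂ = b⁻¹(1)), such that V₁ is finite and each vertex of V₁ has a finite neighbor set. Then G has a matching saturating V₁ if and only if for every subset S ⊆ V₁, the cardinality of S is at most the cardinality of the neighborhood Γ(S) = {w | ∃ v ∈ S, G.adj v w}. -/
/-- A matching of a simple graph `G`, as a set of edges of `G` no two of which share an
incident vertex. -/
structure GraphMatching {V : Type*} (G : SimpleGraph V) where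
  edges : Set (Sym2 V)
  subset_edgeSet : edges ⊆ G.edgeSet
  disjoint : ∀ e ∈ edges, ∀ e' ∈ edges, ∀ v : V, v ∈ e → v ∈ e' → e = e'

/-- A matching saturates a set `W` of vertices if every vertex of `W` is incident to an
edge of the matching. -/
def GraphMatching.Saturates {V : Type*} {G : SimpleGraph V} (M : GraphMatching G)
    (W : Set V) : Prop :=
  W ⊆ {v : V | ∃ e ∈ M.edges, v ∈ e}

/-- Hall's Marriage Theorem for bipartite simple graphs: if the color class `V₁ = b⁻¹(0)`
is finite and every vertex of `V₁` has a finite neighbor set, then `G` has a matching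
saturating `V₁` iff `|S| ≤ |Γ(S)|` for every `S ⊆ V₁`. -/
theorem hall_marriage_theorem_graph {V : Type*} (G : SimpleGraph V)
    (b : G.Coloring (Fin 2))
    (hfin : (b ⁻¹' {0} : Set V).Finite)
    (hnbr : ∀ v ∈ (b ⁻¹' {0} : Set V), (G.neighborSet v).Finite) :
    (∀ S : Set V, S ⊆ b ⁻¹' {0} →
        S.ncard ≤ {w : V | ∃ v ∈ S, G.Adj v w}.ncard) ↔
      ∃ M : GraphMatching G, M.Saturates (b ⁻¹' {0}) := by
  classical
  constructor
  · intro h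
    let t : (b ⁻¹' {0} : Set V) → Finset V := fun v => (hnbr v.1 v.2).toFinset
    have ht : ∀ s : Finset (b ⁻¹' {0} : Set V), s.card ≤ (s.biUnion t).card := by
      intro s
      have h1 := h (Subtype.val '' (s : Set (b ⁻¹' {0} : Set V))) (by
        rintro _ ⟨x, _, rfl⟩
        exact x.2)
      rw [Set.ncard_image_of_injective _ Subtype.val_injective, Set.ncard_coe_finset] at h1
      refine h1.trans (le_of_eq ?_)
      rw [← Set.ncard_coe_finset]
      congr 1
      ext w
      simp [t]
    obtain ⟨f, hf, hft⟩ := (Finset.all_card_le_biUnion_card_iff_exists_injective t).1 ht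
    have hadj : ∀ x, G.Adj x.1 (f x) := by
      intro x
      simpa [t] using hft x
    have hne : ∀ x y : (b ⁻¹' {0} : Set V), x.1 ≠ f y := by
      intro x y hxy
      apply b.valid (hadj y)
      have hx : b x.1 = 0 := x.2
      have hy : b y.1 = 0 := y.2
      rw [← hxy, hx, hy]
    refine ⟨⟨Set.range (fun x => s(x.1, f x)), ?_, ?_⟩, ?_⟩
    · rintro _ ⟨x, rfl⟩
      exact hadj x
    · rintro _ ⟨x, rfl⟩ _ ⟨y, rfl⟩ v hx hy
      simp only [Sym2.mem_iff] at hx hy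
      have hxy : x = y := by
        rcases hx with hx | hx <;> rcases hy with hy | hy
        · exact Subtype.ext (hx.symm.trans hy)
        · exact absurd (hx.symm.trans hy) (hne x y)
        · exact absurd (hy.symm.trans hx) (hne y x)
        · exact hf (hx.symm.trans hy)
      rw [hxy]
    · intro v hv
      exact ⟨_, ⟨⟨v, hv⟩, rfl⟩, Sym2.mem_mk_left _ _⟩
  · rintro ⟨M, hM⟩ S hS
    have hex : ∀ v : V, ∃ w, v ∈ S → s(v, w) ∈ M.edges := by
      intro v
      by_cases hv : v ∈ S
      · obtain ⟨e, he, hve⟩ := hM (hS hv)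
        obtain ⟨w, rfl⟩ := hve
        exact ⟨w, fun _ => he⟩
      · exact ⟨v, fun h => absurd h hv⟩
    choose g hg using hex
    have hfinN : {w : V | ∃ v ∈ S, G.Adj v w}.Finite := by
      refine (hfin.biUnion hnbr).subset ?_
      rintro w ⟨v, hv, hvw⟩
      exact Set.mem_biUnion (hS hv) hvw
    refine Set.ncard_le_ncard_of_injOn g ?_ ?_ hfinN
    · intro v hv
      exact ⟨v, hv, M.subset_edgeSet (hg v hv)⟩
    · intro v hv w hw hvw
      have he := M.disjoint _ (hg v hv) _ (hg w hw) (g v) (Sym2.mem_mk_right _ _)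
        (by rw [hvw]; exact Sym2.mem_mk_right _ _)
      rw [hvw] at he
      exact Sym2.congr_left.1 he
end

section
/- (Inductive step, case 1.) Let α be a finite type with at least two elements, β a finite type, n a natural number with |α| ≤ n + 1, and r : α → β → Prop a relation such that every nonempty proper finite subset A of α satisfies |A| < |r(A)| (and Hall's condition holds for all A). Assume the inductive hypothesis: for all finite types α', β' with |α'| ≤ n and every relation r' : α' → β' → Prop satisfying Hall's condition, there is an injective f' : α' → β' respecting r'. Then there exists an injective function f : α → β with r a (f a) for all a : α. -/
open Classical in
/-- The image `r(A) = {b : β | ∃ a ∈ A, r a b}` of a finite set `A` under a relation `r`. -/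
noncomputable def imageRel {α β : Type*} [Fintype β] (r : α → β → Prop) (A : Finset α) :
    Finset β :=
  Finset.univ.filter (fun b => ∃ a ∈ A, r a b)

universe u

/-- Inductive step of the hard direction of Hall's theorem, case 1: every nonempty proper
subset satisfies the strict inequality. -/
theorem hall_hard_inductive_step_1 {α β : Type u} [Fintype α] [Fintype β] [Nontrivial α]
    {n : ℕ} (hn : Fintype.card α ≤ n + 1) (r : α → β → Prop)
    (hr : ∀ A : Finset α, A.card ≤ (imageRel r A).card)
    (ha : ∀ A : Finset α, A.Nonempty → A ≠ Finset.univ → A.card < (imageRel r A).card)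
    (ih : ∀ (α' β' : Type u) [Fintype α'] [Fintype β'] (r' : α' → β' → Prop),
      Fintype.card α' ≤ n →
      (∀ A' : Finset α', A'.card ≤ (imageRel r' A').card) →
      ∃ f' : α' → β', Function.Injective f' ∧ ∀ x, r' x (f' x)) :
    ∃ f : α → β, Function.Injective f ∧ ∀ a, r a (f a) := by
  classical
  obtain ⟨a⟩ : Nonempty α := inferInstance
  -- pick `b ∈ r({a})`
  obtain ⟨b, hb⟩ : (imageRel r {a}).Nonempty := by
    rw [← Finset.card_pos]
    have := hr {a}
    rw [Finset.card_singleton] at this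
    omega
  have hab : r a b := by simpa [imageRel] using hb
  -- apply the inductive hypothesis after removing `a` and `b`
  obtain ⟨f', hinj, hf'⟩ := ih {x : α // x ≠ a} {y : β // y ≠ b} (fun x y => r x.1 y.1)
    (by
      have : Fintype.card {x : α // x ≠ a} = Fintype.card α - 1 := by
        simp [Fintype.card_subtype_compl]
      omega)
    (by
      intro A'
      rcases A'.eq_empty_or_nonempty with rfl | hne
      · simp
      have hlt := ha (A'.map (Function.Embedding.subtype _)) (by simpa using hne) (by
        intro h
        have : a ∈ A'.map (Function.Embedding.subtype _) := h ▸ Finset.mem_univ a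
        simp at this)
      rw [Finset.card_map] at hlt
      have hsub : (imageRel r (A'.map (Function.Embedding.subtype _))).erase b ⊆
          (imageRel (fun (x : {x : α // x ≠ a}) (y : {y : β // y ≠ b}) => r x.1 y.1) A').map
            (Function.Embedding.subtype _) := by
        intro y hy
        simp only [imageRel, Finset.mem_erase, Finset.mem_filter, Finset.mem_univ, true_and,
          Finset.mem_map] at hy ⊢
        obtain ⟨hyb, _, ⟨x, hx, rfl⟩, hxy⟩ := hy
        exact ⟨⟨y, hyb⟩, ⟨x, hx, hxy⟩, rfl⟩
      have h1 := Finset.card_le_card hsub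
      rw [Finset.card_map] at h1
      have h2 := Finset.pred_card_le_card_erase (a := b)
        (s := imageRel r (A'.map (Function.Embedding.subtype _)))
      omega)
  refine ⟨fun x => if h : x = a then b else (f' ⟨x, h⟩).1, ?_, ?_⟩
  · intro x y hxy
    by_cases hx : x = a <;> by_cases hy : y = a
    · rw [hx, hy]
    · simp only [hx, hy, dite_true, dite_false] at hxy
      exact absurd hxy.symm (f' ⟨y, hy⟩).2
    · simp only [hx, hy, dite_true, dite_false] at hxy
      exact absurd hxy (f' ⟨x, hx⟩).2
    · simp only [hx, hy, dite_false] at hxy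
      exact congrArg Subtype.val (hinj (Subtype.ext hxy))
  · intro x
    by_cases hx : x = a
    · subst hx
      simpa using hab
    · simpa [hx] using hf' ⟨x, hx⟩
end

section
/- (Inductive step, case 2.) Let α be a finite type with at least two elements, β a finite type, n a natural number with |α| ≤ n + 1, and r : α → β → Prop a relation satisfying Hall's condition (|A| ≤ |r(A)| for every finite set A of elements of α). Suppose there exists a nonempty proper finite subset A₀ of α with |A₀| = |r(A₀)|. Assume the inductive hypothesis: for all finite types α', β' with |α'| ≤ n and every relation r' : α' → β' → Prop satisfying Hall's condition, there is an injective f' : α' → β' respecting r'. Then there exists an injective function f : α → β with r a (f a) for all a : α. -/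
universe u

/-- Inductive step of the hard direction of Hall's theorem, case 2: some nonempty proper
subset attains equality in Hall's condition. -/
theorem hall_hard_inductive_step_2 {α β : Type u} [Fintype α] [Fintype β] [Nontrivial α]
    {n : ℕ} (hn : Fintype.card α ≤ n + 1) (r : α → β → Prop)
    (hr : ∀ A : Finset α, A.card ≤ (imageRel r A).card)
    (ha : ∃ A₀ : Finset α, A₀.Nonempty ∧ A₀ ≠ Finset.univ ∧
      A₀.card = (imageRel r A₀).card)
    (ih : ∀ (α' β' : Type u) [Fintype α'] [Fintype β'] (r' : α' → β' → Prop),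
      Fintype.card α' ≤ n →
      (∀ A' : Finset α', A'.card ≤ (imageRel r' A').card) →
      ∃ f' : α' → β', Function.Injective f' ∧ ∀ x, r' x (f' x)) :
    ∃ f : α → β, Function.Injective f ∧ ∀ a, r a (f a) := by
  classical
  obtain ⟨A₀, hne, hproper, hcard⟩ := ha
  have hmem : ∀ (A : Finset α) (b : β), b ∈ imageRel r A ↔ ∃ a ∈ A, r a b := by
    intro A b
    simp [imageRel]
  have hlt : A₀.card < Fintype.card α := by
    rw [← Finset.card_univ]
    exact Finset.card_lt_card (Finset.ssubset_univ_iff.mpr hproper)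
  have hpos : 0 < A₀.card := hne.card_pos
  -- the relation restricted to `A₀` and `r(A₀)`
  obtain ⟨f₁, hf₁, hr₁⟩ := ih {a // a ∈ A₀} {b // b ∈ imageRel r A₀}
    (fun a b => r a.1 b.1) (by rw [Fintype.card_coe]; omega) (by
      intro A'
      have h := hr (A'.map (Function.Embedding.subtype _))
      rw [Finset.card_map] at h
      refine h.trans ?_
      rw [← Finset.card_map (Function.Embedding.subtype _)
        (s := imageRel (fun (a : {a // a ∈ A₀}) (b : {b // b ∈ imageRel r A₀}) => r a.1 b.1) A')]
      apply Finset.card_le_card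
      intro b hb
      obtain ⟨a, ha, hab⟩ := (hmem _ _).1 hb
      obtain ⟨a', ha', rfl⟩ := Finset.mem_map.1 ha
      refine Finset.mem_map.2 ⟨⟨b, (hmem _ _).2 ⟨a'.1, a'.2, hab⟩⟩, ?_, rfl⟩
      exact Finset.mem_filter.2 ⟨Finset.mem_univ _, a', ha', hab⟩)
  -- the relation restricted to the two complements
  obtain ⟨f₂, hf₂, hr₂⟩ := ih {a // a ∉ A₀} {b // b ∉ imageRel r A₀}
    (fun a b => r a.1 b.1) (by
      rw [Fintype.card_subtype_compl, Fintype.card_coe]; omega) (by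
      intro A'
      have h := hr (A₀ ∪ A'.map (Function.Embedding.subtype _))
      rw [Finset.card_union_of_disjoint, Finset.card_map] at h
      · have h2 : (imageRel r (A₀ ∪ A'.map (Function.Embedding.subtype _))).card ≤
            (imageRel r A₀ ∪ (imageRel (fun (a : {a // a ∉ A₀})
              (b : {b // b ∉ imageRel r A₀}) => r a.1 b.1) A').map
                (Function.Embedding.subtype _)).card := by
          apply Finset.card_le_card
          intro b hb
          rw [Finset.mem_union]
          by_cases hb₀ : b ∈ imageRel r A₀
          · exact Or.inl hb₀
          · right
            obtain ⟨a, ha, hab⟩ := (hmem _ _).1 hb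
            rcases Finset.mem_union.1 ha with ha | ha
            · exact absurd ((hmem _ _).2 ⟨a, ha, hab⟩) hb₀
            · obtain ⟨a', ha', rfl⟩ := Finset.mem_map.1 ha
              refine Finset.mem_map.2 ⟨⟨b, hb₀⟩, ?_, rfl⟩
              exact Finset.mem_filter.2 ⟨Finset.mem_univ _, a', ha', hab⟩
        have h3 := h2.trans (Finset.card_union_le _ _)
        rw [Finset.card_map] at h3
        omega
      · rw [Finset.disjoint_left]
        intro a ha ha'
        obtain ⟨a', _, rfl⟩ := Finset.mem_map.1 ha'
        exact a'.2 ha)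
  -- glue the two injections
  refine ⟨fun a => if h : a ∈ A₀ then (f₁ ⟨a, h⟩).1 else (f₂ ⟨a, h⟩).1, ?_, ?_⟩
  · intro x y hxy
    by_cases hx : x ∈ A₀ <;> by_cases hy : y ∈ A₀ <;>
      simp only [hx, hy, dite_true, dite_false] at hxy
    · exact congrArg Subtype.val (hf₁ (Subtype.ext hxy))
    · exact absurd (hxy ▸ (f₁ ⟨x, hx⟩).2) (f₂ ⟨y, hy⟩).2
    · exact absurd (hxy ▸ (f₁ ⟨y, hy⟩).2) (f₂ ⟨x, hx⟩).2
    · exact congrArg Subtype.val (hf₂ (Subtype.ext hxy))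
  · intro a
    by_cases h : a ∈ A₀
    · simpa only [h, dite_true] using hr₁ ⟨a, h⟩
    · simpa only [h, dite_false] using hr₂ ⟨a, h⟩
end

section
/- (Full inductive step.) Let α be a finite type with at least two elements, β a finite type, n a natural number with |α| ≤ n + 1, and r : α → β → Prop a relation satisfying Hall's condition (|A| ≤ |r(A)| for every finite set A of elements of α). Assume the inductive hypothesis: for all finite types α', β' with |α'| ≤ n and every relation r' : α' → β' → Prop satisfying Hall's condition, there is an injective f' : α' → β' respecting r'. Then there exists an injective function f : α → β with r a (f a) for all a : α. -/
universe u

/-- Membership in the image of a finite set under a relation. -/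
theorem mem_imageRel {α β : Type*} [Fintype β] (r : α → β → Prop) (A : Finset α) (b : β) :
    b ∈ imageRel r A ↔ ∃ a ∈ A, r a b := by
  simp [imageRel]

open Classical in
/-- Restricting the relation to a subtype of `α` and to the complement of `S` in `β` loses
exactly the part of the image inside `S`. -/
theorem imageRel_subset_restrict {α β : Type*} [Fintype β] (r : α → β → Prop) (p : α → Prop)
    (S : Finset β) (A : Finset {a // p a}) :
    imageRel r (A.map (Function.Embedding.subtype p)) ⊆
      S ∪ (imageRel (fun (a : {a // p a}) (b : {b // b ∉ S}) => r a b) A).map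
        (Function.Embedding.subtype _) := by
  intro b hb
  rw [mem_imageRel] at hb
  obtain ⟨a, ha, hab⟩ := hb
  obtain ⟨a', ha', rfl⟩ := Finset.mem_map.1 ha
  by_cases hS : b ∈ S
  · exact Finset.mem_union_left _ hS
  · refine Finset.mem_union_right _ (Finset.mem_map.2 ⟨⟨b, hS⟩, ?_, rfl⟩)
    exact (mem_imageRel _ _ _).2 ⟨a', ha', hab⟩

/-- Full inductive step of the hard direction of Hall's theorem. -/
theorem hall_hard_inductive_step {α β : Type u} [Fintype α] [Fintype β] [Nontrivial α]
    {n : ℕ} (hn : Fintype.card α ≤ n + 1) (r : α → β → Prop)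
    (hr : ∀ A : Finset α, A.card ≤ (imageRel r A).card)
    (ih : ∀ (α' β' : Type u) [Fintype α'] [Fintype β'] (r' : α' → β' → Prop),
      Fintype.card α' ≤ n →
      (∀ A' : Finset α', A'.card ≤ (imageRel r' A').card) →
      ∃ f' : α' → β', Function.Injective f' ∧ ∀ x, r' x (f' x)) :
    ∃ f : α → β, Function.Injective f ∧ ∀ a, r a (f a) := by
  classical
  by_cases hs : ∀ A : Finset α, A.Nonempty → A ≠ Finset.univ → A.card < (imageRel r A).card
  · -- every nonempty proper subset satisfies a strict inequality
    obtain ⟨a₀⟩ : Nonempty α := inferInstance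
    have h0 : 0 < (imageRel r {a₀}).card := lt_of_lt_of_le (by simp) (hr {a₀})
    obtain ⟨b₀, hb₀⟩ := Finset.card_pos.1 h0
    have hab : r a₀ b₀ := by simpa [mem_imageRel] using hb₀
    obtain ⟨f, hf, hfr⟩ := ih {a // a ≠ a₀} {b // b ∉ ({b₀} : Finset β)} (fun a b => r a b)
      (by
        have := Fintype.card_subtype_lt (p := fun a => a ≠ a₀) (x := a₀) (by simp)
        omega)
      (by
        intro A
        rcases A.eq_empty_or_nonempty with rfl | hA
        · simp
        have h1 := hs (A.map (Function.Embedding.subtype _)) (hA.map) (by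
          intro h
          have := h ▸ Finset.mem_univ a₀
          simp at this)
        have h2 := (Finset.card_le_card (imageRel_subset_restrict r _ {b₀} A)).trans
          (Finset.card_union_le _ _)
        simp only [Finset.card_map, Finset.card_singleton] at h1 h2
        omega)
    have hne : ∀ x, (f x : β) ≠ b₀ := fun x => by simpa using (f x).2
    refine ⟨fun a => if h : a = a₀ then b₀ else f ⟨a, h⟩, ?_, ?_⟩
    · intro x y hxy
      by_cases hx : x = a₀ <;> by_cases hy : y = a₀
      · rw [hx, hy]
      · simp only [hx, hy, dite_true, dite_false] at hxy
        exact absurd hxy.symm (hne _)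
      · simp only [hx, hy, dite_true, dite_false] at hxy
        exact absurd hxy (hne _)
      · simp only [hx, hy, dite_false] at hxy
        exact congrArg Subtype.val (hf (Subtype.ext hxy))
    · intro a
      by_cases h : a = a₀
      · simpa [h] using hab
      · simpa [h] using hfr ⟨a, h⟩
  · -- some nonempty proper subset attains equality
    push Not at hs
    obtain ⟨A, hA, hAu, hle⟩ := hs
    have hAlt : A.card < Fintype.card α :=
      Finset.card_lt_univ_of_notMem (x := (by
        exact Classical.choose (not_forall.1 (mt Finset.eq_univ_iff_forall.2 hAu))))
        (Classical.choose_spec (not_forall.1 (mt Finset.eq_univ_iff_forall.2 hAu)))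
    obtain ⟨f, hf, hfr⟩ := ih {a // a ∈ A} {b // b ∉ (∅ : Finset β)} (fun a b => r a b)
      (by
        rw [Fintype.card_coe]
        omega)
      (by
        intro B
        have h1 := hr (B.map (Function.Embedding.subtype _))
        have h2 := (Finset.card_le_card (imageRel_subset_restrict r (fun a => a ∈ A) ∅ B)).trans
          (Finset.card_union_le _ _)
        simp only [Finset.card_map, Finset.card_empty] at h1 h2
        omega)
    obtain ⟨g, hg, hgr⟩ := ih {a // a ∉ A} {b // b ∉ imageRel r A} (fun a b => r a b)
      (by
        obtain ⟨x, hx⟩ := hA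
        have := Fintype.card_subtype_lt (p := fun a => a ∉ A) (x := x) (by simpa using hx)
        omega)
      (by
        intro B
        have hdisj : Disjoint A (B.map (Function.Embedding.subtype _)) := by
          rw [Finset.disjoint_left]
          intro x hx hxB
          obtain ⟨y, -, rfl⟩ := Finset.mem_map.1 hxB
          exact y.2 hx
        have h1 := hr (A ∪ B.map (Function.Embedding.subtype _))
        have hsub : imageRel r (A ∪ B.map (Function.Embedding.subtype _)) ⊆
            imageRel r A ∪ (imageRel
              (fun (a : {a // a ∉ A}) (b : {b // b ∉ imageRel r A}) => r a b) B).map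
              (Function.Embedding.subtype _) := by
          intro b hb
          obtain ⟨a, ha, hab⟩ := (mem_imageRel _ _ _).1 hb
          rcases Finset.mem_union.1 ha with ha | ha
          · exact Finset.mem_union_left _ ((mem_imageRel _ _ _).2 ⟨a, ha, hab⟩)
          · exact imageRel_subset_restrict r _ _ B ((mem_imageRel _ _ _).2 ⟨a, ha, hab⟩)
        have h2 := (Finset.card_le_card hsub).trans (Finset.card_union_le _ _)
        rw [Finset.card_union_of_disjoint hdisj] at h1
        simp only [Finset.card_map] at h1 h2
        omega)
    have hfm : ∀ x, (f x : β) ∈ imageRel r A := fun x =>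
      (mem_imageRel _ _ _).2 ⟨x, x.2, hfr x⟩
    refine ⟨fun a => if h : a ∈ A then (f ⟨a, h⟩ : β) else g ⟨a, h⟩, ?_, ?_⟩
    · intro x y hxy
      by_cases hx : x ∈ A <;> by_cases hy : y ∈ A <;>
        simp only [hx, hy, dite_true, dite_false] at hxy
      · exact congrArg Subtype.val (hf (Subtype.ext hxy))
      · exact absurd (hxy ▸ hfm ⟨x, hx⟩) (g ⟨y, hy⟩).2
      · exact absurd (hxy ▸ hfm ⟨y, hy⟩) (g ⟨x, hx⟩).2
      · exact congrArg Subtype.val (hg (Subtype.ext hxy))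
    · intro a
      by_cases h : a ∈ A
      · simpa [h] using hfr ⟨a, h⟩
      · simpa [h] using hgr ⟨a, h⟩
end

section
/- Let G be a simple graph on a finite vertex type V. Then there exists a function f : V → V such that G.adj v (f v) for every v, and the map v ↦ ⟦(v, f v)⟧ (sending each vertex to the unordered edge {v, f v}) is injective, if and only if for every finite set U of vertices, the cardinality of U is at most the number of edges of G incident to at least one vertex of U. -/
/-- A finite simple graph carries a function iff every finite set `U` of vertices has at
most as many elements as there are edges incident to a vertex of `U`. -/
theorem exists_carried_fun_iff {V : Type*} [Fintype V] [DecidableEq V]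
    (G : SimpleGraph V) [DecidableRel G.Adj] :
    (∃ f : V → V, (∀ v, G.Adj v (f v)) ∧ Function.Injective (fun v => s(v, f v))) ↔
      ∀ U : Finset V, U.card ≤ (U.biUnion (fun u => G.incidenceFinset u)).card := by
  rw [Finset.all_card_le_biUnion_card_iff_exists_injective]
  constructor
  · rintro ⟨f, hf, hinj⟩
    refine ⟨fun v => s(v, f v), hinj, fun v => ?_⟩
    rw [SimpleGraph.mem_incidenceFinset]
    exact ⟨hf v, Sym2.mem_mk_left _ _⟩
  · rintro ⟨e, hinj, he⟩
    have key : ∀ v, ∃ w, G.Adj v w ∧ s(v, w) = e v := by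
      intro v
      have h := he v
      rw [SimpleGraph.mem_incidenceFinset] at h
      obtain ⟨h1, w, hw⟩ := h
      refine ⟨w, ?_, hw.symm⟩
      rw [hw] at h1
      exact h1
    choose f hf hfe using key
    refine ⟨f, hf, ?_⟩
    intro a b hab
    apply hinj
    rw [← hfe a, ← hfe b]
    exact hab
end
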